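/- Let λ ∈ C. Then: (a) λ is isolated (i.e. the only vector of V fixed by every element of W°(λ) is 0) if and only if Δ̃ ∖ I_λ has exactly one element; (b) λ is quasi-isolated with respect to L (i.e. the only vector of V fixed by every element of W_L(λ) is 0) if and only if the group A_L(λ) := {w ∈ W | w(λ) − λ ∈ L and w(I_λ) = I_λ} acts transitively on Δ̃ ∖ I_λ. -/

import Mathlib

open Module

/-- A reduced, irreducible, crystallographic root system `Φ` inside the dual of a
`ℚ`-vector space `V`: each root `α` has a coroot `α∨ ∈ V` with `⟨α, α∨⟩ = 2`, pairings
between roots and coroots are integers, the dual reflections permute the roots, the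
system is reduced, the roots span `V*`, and the system is irreducible. -/
structure RootSystemData (V : Type*) [AddCommGroup V] [Module ℚ V] where
  Φ : Set (Module.Dual ℚ V)
  coroot : Module.Dual ℚ V → V
  finite : Φ.Finite
  span_eq_top : Submodule.span ℚ Φ = ⊤
  pairing_self : ∀ α ∈ Φ, α (coroot α) = 2
  pairing_int : ∀ α ∈ Φ, ∀ β ∈ Φ, ∃ n : ℤ, (n : ℚ) = β (coroot α)
  reduced : ∀ α ∈ Φ, ∀ c : ℚ, c • α ∈ Φ → c = 1 ∨ c = -1
  dual_refl_mem : ∀ α ∈ Φ, ∀ β ∈ Φ, β - β (coroot α) • α ∈ Φ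
  irreducible : ∀ s : Set (Module.Dual ℚ V), s ⊆ Φ → s.Nonempty →
      (∀ α ∈ s, ∀ β ∈ Φ, β ∉ s → β (coroot α) = 0) → s = Φ

variable {V : Type*} [AddCommGroup V] [Module ℚ V]

/-- The reflections `s_α : v ↦ v - ⟨α, v⟩ α∨` attached to the elements `α` of `S`. -/
def reflSet (R : RootSystemData V) (S : Set (Module.Dual ℚ V)) : Set (V ≃ₗ[ℚ] V) :=
  {w | ∃ α ∈ S, ∀ v, w v = v - α v • R.coroot α}

/-- The subgroup of `GL(V)` generated by the reflections `s_α`, `α ∈ S`. -/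
def weylOf (R : RootSystemData V) (S : Set (Module.Dual ℚ V)) : Subgroup (V ≃ₗ[ℚ] V) :=
  Subgroup.closure (reflSet R S)

/-- The Weyl group `W` of the root system. -/
def weyl (R : RootSystemData V) : Subgroup (V ≃ₗ[ℚ] V) :=
  weylOf R R.Φ

/-- The contragredient action of `w ∈ GL(V)` on the dual space: `β ↦ β ∘ w⁻¹`. -/
def dact (w : V ≃ₗ[ℚ] V) (β : Module.Dual ℚ V) : Module.Dual ℚ V :=
  β.comp (w.symm.toLinearMap)

/-- The coroot lattice `Q∨`. -/
def corootLattice (R : RootSystemData V) : AddSubgroup V :=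
  AddSubgroup.closure (R.coroot '' R.Φ)

/-- The coweight lattice `P∨ = {v ∈ V | ⟨α, v⟩ ∈ ℤ for all α ∈ Φ}`, as a set. -/
def coweightSet (R : RootSystemData V) : Set V :=
  {v | ∀ α ∈ R.Φ, ∃ n : ℤ, (n : ℚ) = α v}

/-- `m_α`: equal to `-1` on `α₀ = -α̃` and `0` elsewhere (in particular on `Δ`). -/
noncomputable def mfun (αt α : Module.Dual ℚ V) : ℚ := by
  classical exact if α = -αt then -1 else 0

/-- The extended (affine) base `Δ̃ = Δ ∪ {-α̃}`. -/
def extBase (Δ : Finset (Module.Dual ℚ V)) (αt : Module.Dual ℚ V) :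
    Set (Module.Dual ℚ V) :=
  insert (-αt) (Δ : Set (Module.Dual ℚ V))

/-- The closed fundamental alcove `C = {λ ∈ V | ⟨α, λ⟩ ≥ m_α for all α ∈ Δ̃}`. -/
def alcove (Δ : Finset (Module.Dual ℚ V)) (αt : Module.Dual ℚ V) : Set V :=
  {x | ∀ α ∈ extBase Δ αt, mfun αt α ≤ α x}

/-- `Φ(λ) = {α ∈ Φ | ⟨α, λ⟩ ∈ ℤ}`. -/
def PhiOf (R : RootSystemData V) (x : V) : Set (Module.Dual ℚ V) :=
  {α | α ∈ R.Φ ∧ ∃ k : ℤ, (k : ℚ) = α x}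

/-- `I_λ = {α ∈ Δ̃ | ⟨α, λ⟩ = m_α}` for `λ ∈ C`. -/
def IOf (Δ : Finset (Module.Dual ℚ V)) (αt : Module.Dual ℚ V) (x : V) :
    Set (Module.Dual ℚ V) :=
  {α | α ∈ extBase Δ αt ∧ α x = mfun αt α}

/-- `W°(λ)`: the subgroup of `W` generated by the reflections `s_α`, `α ∈ Φ(λ)`. -/
def Wcirc (R : RootSystemData V) (x : V) : Subgroup (V ≃ₗ[ℚ] V) :=
  weylOf R (PhiOf R x)

/-- `𝒜 = {z ∈ W | z(Δ̃) = Δ̃}`: automorphisms of the affine Dynkin diagram induced by `W`. -/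
def AutTilde (R : RootSystemData V) (Δ : Finset (Module.Dual ℚ V))
    (αt : Module.Dual ℚ V) : Set (V ≃ₗ[ℚ] V) :=
  {z | z ∈ weyl R ∧ dact z '' extBase Δ αt = extBase Δ αt}

/-- `𝒜_L = {z ∈ 𝒜 | ϖ∨(z) ∈ L}`, where `ϖ∨(z)` is the unique `v` with `z(C) + v = C`. -/
def AutTildeL (R : RootSystemData V) (Δ : Finset (Module.Dual ℚ V))
    (αt : Module.Dual ℚ V) (L : AddSubgroup V) : Set (V ≃ₗ[ℚ] V) :=
  {z | z ∈ AutTilde R Δ αt ∧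
    ∃ v ∈ L, (fun x => z x + v) '' alcove Δ αt = alcove Δ αt}

/-- The submodule of vectors of `V` fixed by every element of `S`. -/
def fixedSub (S : Set (V ≃ₗ[ℚ] V)) : Submodule ℚ V where
  carrier := {v | ∀ w ∈ S, w v = v}
  add_mem' := by
    intro a b ha hb w hw
    rw [map_add, ha w hw, hb w hw]
  zero_mem' := by
    intro w hw
    exact map_zero w
  smul_mem' := by
    intro c v hv w hw
    rw [map_smul, hv w hw]

/-- The set of orbits of a subgroup `A ≤ GL(V)` acting (contragrediently) on a set `S`
of linear forms. -/
def orbitsOn (A : Subgroup (V ≃ₗ[ℚ] V)) (S : Set (Module.Dual ℚ V)) :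
    Set (Set (Module.Dual ℚ V)) :=
  {O | ∃ α ∈ S, O = {β | ∃ z ∈ A, dact z α = β}}

/-- `λ_Ω = (1/(n_Ω·|Ω|))·Σ_{α∈Ω} ϖ_α∨` (written with `n_α` in place of the constant value
`n_Ω` of `n` on `Ω`). -/
noncomputable def lamOf (n : Module.Dual ℚ V → ℕ) (ϖ : Module.Dual ℚ V → V)
    (Ω : Set (Module.Dual ℚ V)) : V :=
  ∑ᶠ α ∈ Ω, ((n α : ℚ) * (Ω.ncard : ℚ))⁻¹ • ϖ α

/-- `λ` is quasi-isolated with respect to `L` if the only vector fixed by every element of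
`W_L(λ) = {w ∈ W | w(λ) - λ ∈ L}` is `0`. -/
def IsQuasiIsolated (R : RootSystemData V) (L : AddSubgroup V) (x : V) : Prop :=
  fixedSub {w : V ≃ₗ[ℚ] V | w ∈ weyl R ∧ w x - x ∈ L} = ⊥

/-- `𝒬_L`: the set of nonempty subsets `Ω ⊆ Δ̃` whose stabilizer in `𝒜_L` acts
transitively on `Ω`. -/
def QSetOf (R : RootSystemData V) (Δ : Finset (Module.Dual ℚ V))
    (αt : Module.Dual ℚ V) (L : AddSubgroup V) : Set (Set (Module.Dual ℚ V)) :=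
  {Ω | Ω ⊆ extBase Δ αt ∧ Ω.Nonempty ∧
    ∀ α ∈ Ω, ∀ β ∈ Ω, ∃ z ∈ AutTildeL R Δ αt L, dact z '' Ω = Ω ∧ dact z α = β}


section ContragredientAction

lemma dact_apply (w : V ≃ₗ[ℚ] V) (β : Module.Dual ℚ V) (v : V) :
    dact w β v = β (w.symm v) := rfl

lemma dact_apply_apply (w : V ≃ₗ[ℚ] V) (β : Module.Dual ℚ V) (v : V) :
    dact w β (w v) = β v := by
  simp [dact_apply]

lemma dact_inv_apply (w : V ≃ₗ[ℚ] V) (β : Module.Dual ℚ V) (v : V) :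
    dact w⁻¹ β v = β (w v) := rfl

lemma dact_mul (w z : V ≃ₗ[ℚ] V) (β : Module.Dual ℚ V) :
    dact (w * z) β = dact w (dact z β) := rfl

lemma dact_inv_dact (w : V ≃ₗ[ℚ] V) (β : Module.Dual ℚ V) :
    dact w⁻¹ (dact w β) = β :=
  LinearMap.ext fun v => congrArg β (w.symm_apply_apply v)

lemma dact_dact_inv (w : V ≃ₗ[ℚ] V) (β : Module.Dual ℚ V) :
    dact w (dact w⁻¹ β) = β :=
  LinearMap.ext fun v => congrArg β (w.apply_symm_apply v)

end ContragredientAction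

section WeylGroup

variable (R : RootSystemData V)

lemma RootSystemData.neg_mem {α : Module.Dual ℚ V} (hα : α ∈ R.Φ) : -α ∈ R.Φ := by
  have h := R.dual_refl_mem α hα α hα
  rw [R.pairing_self α hα] at h
  convert h using 1
  module

lemma exists_mem_reflSet {S : Set (Module.Dual ℚ V)} (hS : S ⊆ R.Φ) {α : Module.Dual ℚ V}
    (hα : α ∈ S) : ∃ w ∈ reflSet R S, ∀ v, w v = v - α v • R.coroot α :=
  ⟨Module.reflection (R.pairing_self α (hS hα)),
    ⟨α, hα, fun v => Module.reflection_apply v _⟩, fun v => Module.reflection_apply v _⟩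

lemma Wcirc_le_weyl (x : V) : Wcirc R x ≤ weyl R :=
  Subgroup.closure_mono fun _ ⟨α, hα, h⟩ => ⟨α, hα.1, h⟩

lemma dact_eq_of_mem_reflSet {α : Module.Dual ℚ V} (hα : α ∈ R.Φ) {w : V ≃ₗ[ℚ] V}
    (hw : ∀ v, w v = v - α v • R.coroot α) (β : Module.Dual ℚ V) :
    dact w β = β - β (R.coroot α) • α := by
  have hsymm (v : V) : w.symm v = w v := by
    rw [LinearEquiv.symm_apply_eq, hw (w v), hw v]
    simp only [map_sub, map_smul, R.pairing_self α hα, smul_eq_mul]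
    module
  ext v
  simp only [dact_apply, hsymm, hw, map_sub, map_smul, smul_eq_mul, LinearMap.sub_apply,
    LinearMap.smul_apply]
  ring

lemma dact_mem_iff {w : V ≃ₗ[ℚ] V} (hw : w ∈ weyl R) :
    ∀ β, dact w β ∈ R.Φ ↔ β ∈ R.Φ := by
  induction hw using Subgroup.closure_induction with
  | mem w hw =>
    obtain ⟨α, hα, h⟩ := hw
    have key (β : Module.Dual ℚ V) (hβ : β ∈ R.Φ) : dact w β ∈ R.Φ := by
      rw [dact_eq_of_mem_reflSet R hα h]
      exact R.dual_refl_mem α hα β hβ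
    refine fun β => ⟨fun hβ => ?_, key β⟩
    convert key _ hβ using 1
    simp only [dact_eq_of_mem_reflSet R hα h, LinearMap.sub_apply, LinearMap.smul_apply,
      R.pairing_self α hα, smul_eq_mul]
    module
  | one => exact fun _ => Iff.rfl
  | mul w z _ _ hw hz => intro β; rw [dact_mul, hw, hz]
  | inv w _ hw => intro β; rw [← hw, dact_dact_inv]

lemma apply_mem_of_mem_weyl {L : AddSubgroup V} (hQL : (corootLattice R : Set V) ⊆ L)
    (hLP : (L : Set V) ⊆ coweightSet R) {w : V ≃ₗ[ℚ] V} (hw : w ∈ weyl R) :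
    ∀ l, w l ∈ L ↔ l ∈ L := by
  induction hw using Subgroup.closure_induction with
  | mem w hw =>
    obtain ⟨α, hα, h⟩ := hw
    have key (l : V) (hl : l ∈ L) : w l ∈ L := by
      obtain ⟨k, hk⟩ := hLP hl α hα
      rw [h, ← hk, Int.cast_smul_eq_zsmul]
      exact L.sub_mem hl (L.zsmul_mem (hQL (AddSubgroup.subset_closure ⟨α, hα, rfl⟩)) k)
    refine fun l => ⟨fun hl => ?_, key l⟩
    convert key _ hl using 1
    simp only [h, map_sub, map_smul, R.pairing_self α hα, smul_eq_mul]
    module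
  | one => exact fun _ => Iff.rfl
  | mul w z _ _ hw hz => intro l; rw [LinearEquiv.mul_apply, hw, hz]
  | inv w _ hw =>
    intro l
    rw [← hw]
    exact iff_of_eq (congrArg (· ∈ L) (w.apply_symm_apply l))

lemma mem_fixedSub_Wcirc_iff {x v : V} :
    v ∈ fixedSub (Wcirc R x : Set (V ≃ₗ[ℚ] V)) ↔ ∀ α ∈ PhiOf R x, α v = 0 := by
  constructor
  · intro hv α hα
    obtain ⟨w, hw, h⟩ := exists_mem_reflSet R (fun _ h => h.1) hα
    have h1 : w v = v := hv w (Subgroup.subset_closure hw)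
    rw [h, sub_eq_self] at h1
    have h2 := congrArg α h1
    rw [map_smul, R.pairing_self α hα.1, map_zero, smul_eq_mul] at h2
    linarith
  · intro hv w hw
    induction hw using Subgroup.closure_induction with
    | mem w hw =>
      obtain ⟨α, hα, h⟩ := hw
      rw [h, hv α hα, zero_smul, sub_zero]
    | one => rfl
    | mul w z _ _ hw hz => rw [LinearEquiv.mul_apply, hz, hw]
    | inv w _ hw => exact w.symm_apply_eq.2 hw.symm

/-- The canonical `W`-invariant symmetric bilinear form `∑ β, β(y) β(v)`. -/
noncomputable def canonicalForm (y v : V) : ℚ :=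
  ∑ β ∈ R.finite.toFinset, β y * β v

lemma canonicalForm_map {w : V ≃ₗ[ℚ] V} (hw : w ∈ weyl R) (y v : V) :
    canonicalForm R (w y) (w v) = canonicalForm R y v := by
  refine Finset.sum_bij' (fun β _ => dact w⁻¹ β) (fun β _ => dact w β) ?_ ?_ ?_ ?_ ?_
  · intro β hβ
    simpa using (dact_mem_iff R (inv_mem hw) β).2 (by simpa using hβ)
  · intro β hβ
    simpa using (dact_mem_iff R hw β).2 (by simpa using hβ)
  · exact fun β _ => dact_dact_inv w β
  · exact fun β _ => dact_inv_dact w β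
  · exact fun β _ => rfl

lemma canonicalForm_coroot_pos {α : Module.Dual ℚ V} (hα : α ∈ R.Φ) {v : V} (hv : 0 < α v) :
    0 < canonicalForm R (R.coroot α) v := by
  obtain ⟨w, hw, h⟩ := exists_mem_reflSet R subset_rfl hα
  have hinv := canonicalForm_map R (Subgroup.subset_closure hw) (R.coroot α) v
  have hself : 0 < canonicalForm R (R.coroot α) (R.coroot α) := by
    refine Finset.sum_pos' (fun β _ => mul_self_nonneg _) ⟨α, by simpa using hα, ?_⟩
    rw [R.pairing_self α hα]
    norm_num
  have hexp : canonicalForm R (w (R.coroot α)) (w v) =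
      α v * canonicalForm R (R.coroot α) (R.coroot α) - canonicalForm R (R.coroot α) v := by
    simp only [canonicalForm, Finset.mul_sum, ← Finset.sum_sub_distrib]
    refine Finset.sum_congr rfl fun β _ => ?_
    simp only [h, R.pairing_self α hα, map_sub, map_smul, smul_eq_mul]
    ring
  nlinarith [mul_pos hv hself]

/-- The values of the canonical form on a `W°(x)`-orbit are bounded by an attained maximum. -/
lemma exists_canonicalForm_max (x y v : V) :
    ∃ u ∈ Wcirc R x, ∀ z ∈ Wcirc R x, canonicalForm R (z y) v ≤ canonicalForm R (u y) v := by
  have : Finite R.Φ := R.finite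
  have hfin : ((fun u : V ≃ₗ[ℚ] V => canonicalForm R (u y) v) '' (Wcirc R x)).Finite := by
    refine (Set.finite_range fun σ : R.finite.toFinset → R.Φ =>
      ∑ β : R.finite.toFinset, (σ β : Module.Dual ℚ V) y * β.1 v).subset ?_
    rintro _ ⟨u, hu, rfl⟩
    refine ⟨fun β => ⟨dact u⁻¹ β, (dact_mem_iff R (inv_mem (Wcirc_le_weyl R x hu)) _).2
      (R.finite.mem_toFinset.1 β.2)⟩, ?_⟩
    exact Finset.sum_coe_sort R.finite.toFinset fun β => dact u⁻¹ β y * β v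
  obtain ⟨_, ⟨u, hu, rfl⟩, hmax⟩ :=
    hfin.exists_maximalFor id _ ⟨_, 1, one_mem (Wcirc R x), rfl⟩
  refine ⟨u, hu, fun z hz => ?_⟩
  by_contra! hlt
  exact absurd (hmax ⟨z, hz, rfl⟩ hlt.le) (not_le.2 hlt)

/-- If the roots of `S ⊆ Φ(x)` are positive on some vector and vanish nowhere on the
`W°(x)`-orbit of `y`, then this orbit meets the open chamber cut out by `S`. -/
lemma exists_mem_Wcirc_forall_pos {x y v : V} {S : Set (Module.Dual ℚ V)}
    (hS : S ⊆ PhiOf R x) (hv : ∀ a ∈ S, 0 < a v)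
    (hy : ∀ u ∈ Wcirc R x, ∀ a ∈ S, a (u y) ≠ 0) :
    ∃ u ∈ Wcirc R x, ∀ a ∈ S, 0 < a (u y) := by
  obtain ⟨u, hu, hmax⟩ := exists_canonicalForm_max R x y v
  refine ⟨u, hu, fun a ha => (hy u hu a ha).lt_or_gt.resolve_left fun hneg => ?_⟩
  obtain ⟨w, hw, h⟩ := exists_mem_reflSet R (fun _ h => h.1) (hS ha)
  have hle := hmax (w * u) (mul_mem (Subgroup.subset_closure hw) hu)
  have hexp : canonicalForm R ((w * u) y) v =
      canonicalForm R (u y) v - a (u y) * canonicalForm R (R.coroot a) v := by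
    simp only [canonicalForm, Finset.mul_sum, ← Finset.sum_sub_distrib]
    refine Finset.sum_congr rfl fun β _ => ?_
    simp only [LinearEquiv.mul_apply, h, map_sub, map_smul, smul_eq_mul]
    ring
  have := canonicalForm_coroot_pos R (hS ha).1 (hv a ha)
  nlinarith [mul_pos (neg_pos.2 hneg) this]

end WeylGroup

section Stabilizers

variable (R : RootSystemData V)

/-- The group `W_L(x) = {w ∈ W | w(x) - x ∈ L}`. -/
def latticeStabilizer {L : AddSubgroup V} (hQL : (corootLattice R : Set V) ⊆ L)
    (hLP : (L : Set V) ⊆ coweightSet R) (x : V) : Subgroup (V ≃ₗ[ℚ] V) where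
  carrier := {w | w ∈ weyl R ∧ w x - x ∈ L}
  mul_mem' := by
    rintro w z ⟨hw, hwx⟩ ⟨hz, hzx⟩
    have h := L.add_mem ((apply_mem_of_mem_weyl R hQL hLP hw _).2 hzx) hwx
    rw [map_sub, sub_add_sub_cancel, ← LinearEquiv.mul_apply] at h
    exact ⟨mul_mem hw hz, h⟩
  one_mem' := ⟨one_mem _, by simp⟩
  inv_mem' := by
    rintro w ⟨hw, hwx⟩
    refine ⟨inv_mem hw, ?_⟩
    rw [← apply_mem_of_mem_weyl R hQL hLP hw, map_sub, ← neg_mem_iff, neg_sub]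
    convert hwx using 2
    exact w.apply_symm_apply x

/-- The stabilizer in `GL(V)` of a set of linear forms. -/
def formStabilizer (I : Set (Module.Dual ℚ V)) : Subgroup (V ≃ₗ[ℚ] V) where
  carrier := {w | dact w '' I = I}
  mul_mem' := by
    intro w z hw hz
    have h : dact w '' (dact z '' I) = I := by rw [hz, hw]
    rwa [Set.image_image] at h
  one_mem' := Set.image_id I
  inv_mem' := by
    intro w hw
    have h : dact w⁻¹ '' (dact w '' I) = I := by
      simp only [Set.image_image, dact_inv_dact, Set.image_id']
    rwa [hw] at h

lemma mem_formStabilizer_of_forall {I : Set (Module.Dual ℚ V)} {w : V ≃ₗ[ℚ] V}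
    (h : ∀ a ∈ I, dact w a ∈ I) (h' : ∀ a ∈ I, dact w⁻¹ a ∈ I) : w ∈ formStabilizer I := by
  refine Set.Subset.antisymm ?_ fun a ha => ⟨_, h' a ha, dact_dact_inv w a⟩
  rintro _ ⟨a, ha, rfl⟩
  exact h a ha

lemma dact_mem_of_mem_formStabilizer {I : Set (Module.Dual ℚ V)} {w : V ≃ₗ[ℚ] V}
    (hw : w ∈ formStabilizer I) {a : Module.Dual ℚ V} (ha : a ∈ I) : dact w a ∈ I :=
  (show dact w '' I = I from hw).subset ⟨a, ha, rfl⟩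

variable {R}

lemma Wcirc_le_latticeStabilizer {L : AddSubgroup V} (hQL : (corootLattice R : Set V) ⊆ L)
    (hLP : (L : Set V) ⊆ coweightSet R) (x : V) :
    Wcirc R x ≤ latticeStabilizer R hQL hLP x := by
  refine (Subgroup.closure_le _).2 ?_
  rintro w ⟨α, ⟨hα, k, hk⟩, h⟩
  refine ⟨Subgroup.subset_closure ⟨α, hα, h⟩, ?_⟩
  rw [h, ← hk, Int.cast_smul_eq_zsmul, sub_sub_cancel_left]
  exact L.neg_mem (L.zsmul_mem (hQL (AddSubgroup.subset_closure ⟨α, hα, rfl⟩)) k)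

end Stabilizers

section AlcoveFrame

/-- The affine forms `y ↦ a(y) - m_a`, `a ∈ E`, are the walls of an alcove of the affine
hyperplane arrangement of `R`, the numbers `n_a` being the coefficients of the constant
form `1` in terms of them. -/
structure IsAlcoveFrame (R : RootSystemData V) (E : Finset (Module.Dual ℚ V))
    (n m : Module.Dual ℚ V → ℚ) : Prop where
  subset : ∀ a ∈ E, a ∈ R.Φ
  pos : ∀ a ∈ E, 0 < n a
  int : ∀ a ∈ E, ∃ k : ℤ, m a = k
  sum_eq_one : ∀ y, ∑ a ∈ E, n a * (a y - m a) = 1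
  exists_vec : ∀ f : Module.Dual ℚ V → ℚ, ∑ a ∈ E, n a * f a = 0 → ∃ v, ∀ a ∈ E, a v = f a
  eq_zero : ∀ v, (∀ a ∈ E, a v = 0) → v = 0
  exists_comb : ∀ β ∈ R.Φ, ∀ k : ℤ, ∃ c : Module.Dual ℚ V → ℚ, (∀ a ∈ E, 0 ≤ c a) ∧
    ((∀ y, β y + k = ∑ a ∈ E, c a * (a y - m a)) ∨
      (∀ y, -(β y + k) = ∑ a ∈ E, c a * (a y - m a)))

variable {R : RootSystemData V} {E : Finset (Module.Dual ℚ V)} {n m : Module.Dual ℚ V → ℚ}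

/-- The walls of the frame containing `x`. -/
def wallsAt (E : Finset (Module.Dual ℚ V)) (m : Module.Dual ℚ V → ℚ) (x : V) :
    Set (Module.Dual ℚ V) :=
  {a | a ∈ E ∧ a x = m a}

namespace IsAlcoveFrame

lemma sum_mul_apply (F : IsAlcoveFrame R E n m) (v : V) : ∑ a ∈ E, n a * a v = 0 := by
  have h := (F.sum_eq_one v).trans (F.sum_eq_one 0).symm
  rw [← sub_eq_zero, ← Finset.sum_sub_distrib] at h
  rw [← h]
  refine Finset.sum_congr rfl fun a _ => ?_
  rw [map_zero]
  ring

lemma eq_of_forall_sum_eq (F : IsAlcoveFrame R E n m) {c d : Module.Dual ℚ V → ℚ}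
    (h : ∀ y, ∑ a ∈ E, c a * (a y - m a) = ∑ a ∈ E, d a * (a y - m a)) :
    ∀ a ∈ E, c a = d a := by
  classical
  intro a ha
  have hna := (F.pos a ha).ne'
  obtain ⟨v, hv⟩ := F.exists_vec (fun b => (if b = a then (n a)⁻¹ else 0) + m b) (by
    have h0 := F.sum_eq_one 0
    simp only [map_zero, zero_sub, mul_neg, Finset.sum_neg_distrib] at h0
    simp only [mul_add, Finset.sum_add_distrib, mul_ite, mul_zero, Finset.sum_ite_eq', ha,
      if_true, mul_inv_cancel₀ hna]
    linarith)
  have hsum (e : Module.Dual ℚ V → ℚ) :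
      ∑ b ∈ E, e b * (b v - m b) = e a * (n a)⁻¹ := by
    rw [Finset.sum_congr rfl fun b hb => by rw [hv b hb, add_sub_cancel_right]]
    simp [ha]
  have := h v
  rw [hsum, hsum] at this
  exact mul_right_cancel₀ (inv_ne_zero hna) this

lemma exists_comb_of_pos (F : IsAlcoveFrame R E n m) {p : V} (hp : ∀ a ∈ E, 0 < a p - m a)
    {β : Module.Dual ℚ V} (hβ : β ∈ R.Φ) {q : ℚ} (hq : ∃ k : ℤ, q = k) (hpos : 0 < β p + q) :
    ∃ c : Module.Dual ℚ V → ℚ, (∀ a ∈ E, 0 ≤ c a) ∧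
      ∀ y, β y + q = ∑ a ∈ E, c a * (a y - m a) := by
  obtain ⟨k, rfl⟩ := hq
  obtain ⟨c, hc, h | h⟩ := F.exists_comb β hβ k
  · exact ⟨c, hc, h⟩
  · have := Finset.sum_nonneg fun a ha => mul_nonneg (hc a ha) (hp a ha).le
    rw [← h p] at this
    linarith

/-- An affine isometry of the arrangement fixing `x` and mapping some interior point of the
alcove to an interior point permutes the walls of the alcove. -/
lemma dact_mem_of_interior (F : IsAlcoveFrame R E n m) {x v : V} {z : V ≃ₗ[ℚ] V}
    (hz : z ∈ weyl R) (hzx : z x - x ∈ coweightSet R)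
    (hv : ∀ a ∈ E, 0 < a (x + v) - m a) (hzv : ∀ a ∈ E, 0 < a (x + z v) - m a)
    {a : Module.Dual ℚ V} (ha : a ∈ E) :
    dact z a ∈ E ∧ dact z a x - m (dact z a) = a x - m a := by
  classical
  have hz' := inv_mem hz
  have hmem := (dact_mem_iff R hz a).2 (F.subset a ha)
  obtain ⟨C, hC, hCa⟩ := F.exists_comb_of_pos (q := a x - m a - dact z a x) hzv hmem (by
    obtain ⟨k, hk⟩ := F.int a ha
    obtain ⟨j, hj⟩ := hzx _ hmem
    rw [map_sub, dact_apply_apply] at hj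
    exact ⟨j - k, by push_cast; linarith⟩) (by
    have := hv a ha
    rw [map_add] at this ⊢
    rw [dact_apply_apply]
    linarith)
  have key (b : Module.Dual ℚ V) (hb : b ∈ E) :
      ∃ c : Module.Dual ℚ V → ℚ, (∀ a ∈ E, 0 ≤ c a) ∧
        ∀ y, dact z⁻¹ b y + (b x - m b - b (z x)) = ∑ a ∈ E, c a * (a y - m a) := by
    refine F.exists_comb_of_pos hv ((dact_mem_iff R hz' b).2 (F.subset b hb)) ?_ ?_
    · obtain ⟨k, hk⟩ := F.int b hb
      obtain ⟨j, hj⟩ := hzx _ (F.subset b hb)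
      rw [map_sub] at hj
      exact ⟨-j - k, by push_cast; linarith⟩
    · have := hzv b hb
      rw [map_add] at this
      rw [dact_inv_apply, map_add, map_add]
      linarith
  choose! D hD hDb using key
  have hmat : ∀ e ∈ E, ∑ b ∈ E, C b * D b e = if e = a then 1 else 0 := by
    refine F.eq_of_forall_sum_eq fun y => ?_
    have h1 := hCa (z (y - x) + x)
    rw [map_add, dact_apply_apply, map_sub] at h1
    have h2 : ∑ e ∈ E, (∑ b ∈ E, C b * D b e) * (e y - m e) =
        ∑ b ∈ E, C b * (b (z (y - x) + x) - m b) := by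
      simp only [Finset.sum_mul, mul_assoc]
      rw [Finset.sum_comm]
      refine Finset.sum_congr rfl fun b hb => ?_
      rw [← Finset.mul_sum, ← hDb b hb y, dact_inv_apply]
      simp only [map_add, map_sub]
      ring
    rw [h2, ← h1]
    simp only [ite_mul, one_mul, zero_mul, Finset.sum_ite_eq', ha, if_true]
    ring
  obtain ⟨b, hb, hne⟩ : ∃ b ∈ E, C b * D b a ≠ 0 := by
    refine Finset.exists_ne_zero_of_sum_ne_zero ?_
    rw [hmat a ha, if_pos rfl]
    exact one_ne_zero
  have hD0 (e : Module.Dual ℚ V) (he : e ∈ E) (hea : e ≠ a) : D b e = 0 := by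
    have h := hmat e he
    rw [if_neg hea, Finset.sum_eq_zero_iff_of_nonneg
      fun b hb => mul_nonneg (hC b hb) (hD b hb e he)] at h
    exact (mul_eq_zero.1 (h b hb)).resolve_left (left_ne_zero_of_mul hne)
  have hba (y : V) : dact z⁻¹ b y + (b x - m b - b (z x)) = D b a * (a y - m a) := by
    rw [hDb b hb y]
    exact Finset.sum_eq_single a (fun e he hea => by rw [hD0 e he hea, zero_mul])
      fun h => absurd ha h
  have hsmul : dact z⁻¹ b = D b a • a := by
    ext y
    have h1 := hba y
    have h2 := hba 0
    rw [map_zero, map_zero] at h2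
    rw [LinearMap.smul_apply, smul_eq_mul]
    linarith
  have hone : D b a = 1 := by
    refine (R.reduced a (F.subset a ha) (D b a) ?_).resolve_right fun h => ?_
    · rw [← hsmul]
      exact (dact_mem_iff R hz' b).2 (F.subset b hb)
    · have := hD b hb a ha
      linarith
  rw [hone, one_smul] at hsmul
  have hzab : dact z a = b := by rw [← hsmul, dact_dact_inv]
  rw [hzab]
  refine ⟨hb, ?_⟩
  have h := hba x
  rw [hone, dact_inv_apply] at h
  linarith

lemma wallsAt_subset_PhiOf (F : IsAlcoveFrame R E n m) (x : V) :
    wallsAt E m x ⊆ PhiOf R x := by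
  rintro a ⟨ha, hax⟩
  obtain ⟨k, hk⟩ := F.int a ha
  exact ⟨F.subset a ha, k, by rw [hax, hk]⟩

lemma exists_comb_wallsAt (F : IsAlcoveFrame R E n m) {x : V} (hx : ∀ a ∈ E, m a ≤ a x)
    {β : Module.Dual ℚ V} (hβ : β ∈ PhiOf R x) :
    ∃ c : Module.Dual ℚ V → ℚ, (∀ a ∈ E, 0 ≤ c a) ∧
      (∀ a ∈ E, a ∉ wallsAt E m x → c a = 0) ∧
      ((∀ v, β v = ∑ a ∈ E, c a * a v) ∨ (∀ v, -β v = ∑ a ∈ E, c a * a v)) := by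
  obtain ⟨hβΦ, k, hk⟩ := hβ
  obtain ⟨c, hc, h⟩ := F.exists_comb β hβΦ (-k)
  push_cast at h
  have hlin (v : V) : ∑ a ∈ E, c a * a v =
      ∑ a ∈ E, c a * (a (x + v) - m a) - ∑ a ∈ E, c a * (a x - m a) := by
    rw [← Finset.sum_sub_distrib]
    refine Finset.sum_congr rfl fun a _ => ?_
    rw [map_add]
    ring
  have hzero : ∑ a ∈ E, c a * (a x - m a) = 0 := by
    rcases h with h | h <;> rw [← h x, hk] <;> ring
  refine ⟨c, hc, fun a ha hax => ?_, h.imp (fun h v => ?_) fun h v => ?_⟩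
  · rw [Finset.sum_eq_zero_iff_of_nonneg
      fun a ha => mul_nonneg (hc a ha) (sub_nonneg.2 (hx a ha))] at hzero
    exact (mul_eq_zero.1 (hzero a ha)).resolve_right
      fun h => hax ⟨ha, sub_eq_zero.1 h⟩
  all_goals
    rw [hlin v, ← h, ← h, map_add]
    ring

lemma mem_fixedSub_Wcirc_iff (F : IsAlcoveFrame R E n m) {x : V} (hx : ∀ a ∈ E, m a ≤ a x)
    {v : V} : v ∈ fixedSub (Wcirc R x : Set (V ≃ₗ[ℚ] V)) ↔ ∀ a ∈ wallsAt E m x, a v = 0 := by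
  rw [_root_.mem_fixedSub_Wcirc_iff]
  refine ⟨fun h a ha => h a (F.wallsAt_subset_PhiOf x ha), fun h β hβ => ?_⟩
  obtain ⟨c, -, hc0, hcomb⟩ := F.exists_comb_wallsAt hx hβ
  have hsum : ∑ a ∈ E, c a * a v = 0 := Finset.sum_eq_zero fun a ha => by
    by_cases hax : a ∈ wallsAt E m x
    · rw [h a hax, mul_zero]
    · rw [hc0 a ha hax, zero_mul]
  rcases hcomb with h' | h'
  · rw [h', hsum]
  · rw [← neg_eq_zero, h', hsum]

lemma apply_ne_zero_of_mem_PhiOf (F : IsAlcoveFrame R E n m) {x : V}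
    (hx : ∀ a ∈ E, m a ≤ a x) {v : V} (hv : ∀ a ∈ wallsAt E m x, 0 < a v)
    {β : Module.Dual ℚ V} (hβ : β ∈ PhiOf R x) : β v ≠ 0 := by
  intro h0
  obtain ⟨c, hc, hc0, hcomb⟩ := F.exists_comb_wallsAt hx hβ
  have hsum : ∑ a ∈ E, c a * a v = 0 := by
    rcases hcomb with h' | h' <;> rw [← h', h0]
    exact neg_zero
  have hnonneg : ∀ a ∈ E, 0 ≤ c a * a v := fun a ha => by
    by_cases hax : a ∈ wallsAt E m x
    · exact mul_nonneg (hc a ha) (hv a hax).le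
    · rw [hc0 a ha hax, zero_mul]
  rw [Finset.sum_eq_zero_iff_of_nonneg hnonneg] at hsum
  have hcz : ∀ a ∈ E, c a = 0 := fun a ha => by
    by_cases hax : a ∈ wallsAt E m x
    · exact (mul_eq_zero.1 (hsum a ha)).resolve_right (hv a hax).ne'
    · exact hc0 a ha hax
  have hz : ∑ a ∈ E, c a * a (R.coroot β) = 0 :=
    Finset.sum_eq_zero fun a ha => by rw [hcz a ha, zero_mul]
  have h2 := R.pairing_self β hβ.1
  rcases hcomb with h' | h'
  · linarith [h' (R.coroot β)]
  · linarith [h' (R.coroot β)]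

lemma exists_notMem_wallsAt (F : IsAlcoveFrame R E n m) (x : V) :
    ∃ a ∈ E, a ∉ wallsAt E m x := by
  by_contra! h
  have h1 := F.sum_eq_one x
  rw [Finset.sum_eq_zero fun a ha => by rw [(h a ha).2, sub_self, mul_zero]] at h1
  exact zero_ne_one h1

lemma exists_pos_on_wallsAt (F : IsAlcoveFrame R E n m) (x : V) :
    ∃ v, ∀ a ∈ wallsAt E m x, 0 < a v := by
  obtain ⟨b, hb, -⟩ := F.exists_notMem_wallsAt x
  have hN : 0 < ∑ a ∈ E, n a := Finset.sum_pos F.pos ⟨b, hb⟩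
  obtain ⟨v, hv⟩ := F.exists_vec (fun a => (∑ a ∈ E, n a)⁻¹ - (a x - m a)) (by
    simp only [mul_sub (n _) _ (_ - _), Finset.sum_sub_distrib, F.sum_eq_one]
    rw [← Finset.sum_mul, mul_inv_cancel₀ hN.ne', sub_self])
  refine ⟨v, fun a ha => ?_⟩
  rw [hv a ha.1, ha.2, sub_self, sub_zero]
  exact inv_pos.2 hN

end IsAlcoveFrame

lemma exists_smul_interior {x y : V} (hx : ∀ a ∈ E, m a ≤ a x)
    (hy : ∀ a ∈ wallsAt E m x, 0 < a y) :
    ∃ t₀ : ℚ, 0 < t₀ ∧ ∀ t, 0 < t → t ≤ t₀ → ∀ a ∈ E, 0 < a (x + t • y) - m a := by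
  have hlocal (a : Module.Dual ℚ V) (ha : a ∈ E) :
      ∃ t₀ : ℚ, 0 < t₀ ∧ ∀ t, 0 < t → t ≤ t₀ → 0 < a (x + t • y) - m a := by
    simp only [map_add, map_smul, smul_eq_mul]
    by_cases hax : a x = m a
    · refine ⟨1, one_pos, fun t ht _ => ?_⟩
      have := mul_pos ht (hy a ⟨ha, hax⟩)
      linarith
    · have hs : 0 < a x - m a := sub_pos.2 ((hx a ha).lt_of_ne' hax)
      have hd : 0 < |a y| + 1 := by positivity
      refine ⟨(a x - m a) / (|a y| + 1), div_pos hs hd, fun t ht hle => ?_⟩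
      rw [le_div_iff₀ hd] at hle
      nlinarith [neg_abs_le (a y)]
  choose! t ht0 ht using hlocal
  rcases E.eq_empty_or_nonempty with rfl | hE
  · exact ⟨1, one_pos, by simp⟩
  · exact ⟨E.inf' hE t, (Finset.lt_inf'_iff hE).2 ht0, fun r hr hle a ha =>
      ht a ha r hr (hle.trans (Finset.inf'_le t ha))⟩

namespace IsAlcoveFrame

/-- If `z` fixes `x` modulo `P∨` and maps a direction pointing into the alcove at `x` to
another such direction, then it permutes the walls of the alcove. -/
lemma dact_mem_of_pos (F : IsAlcoveFrame R E n m) {x v : V} (hx : ∀ a ∈ E, m a ≤ a x)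
    {z : V ≃ₗ[ℚ] V} (hz : z ∈ weyl R) (hzx : z x - x ∈ coweightSet R)
    (hv : ∀ a ∈ wallsAt E m x, 0 < a v) (hzv : ∀ a ∈ wallsAt E m x, 0 < a (z v))
    {a : Module.Dual ℚ V} (ha : a ∈ E) :
    dact z a ∈ E ∧ (a ∈ wallsAt E m x → dact z a ∈ wallsAt E m x) := by
  obtain ⟨t₁, ht₁, h₁⟩ := exists_smul_interior hx hv
  obtain ⟨t₂, ht₂, h₂⟩ := exists_smul_interior hx hzv
  have hpos := lt_min ht₁ ht₂
  obtain ⟨hmem, hval⟩ := F.dact_mem_of_interior hz hzx (h₁ _ hpos (min_le_left _ _))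
    (by simpa only [map_smul] using h₂ _ hpos (min_le_right _ _)) ha
  refine ⟨hmem, fun hax => ⟨hmem, ?_⟩⟩
  rwa [hax.2, sub_self, sub_eq_zero] at hval

variable {L : AddSubgroup V} (hQL : (corootLattice R : Set V) ⊆ L)
    (hLP : (L : Set V) ⊆ coweightSet R)

lemma dact_mem_of_mem_stabilizer (F : IsAlcoveFrame R E n m) {x : V}
    (hx : ∀ a ∈ E, m a ≤ a x) {z : V ≃ₗ[ℚ] V}
    (hz : z ∈ latticeStabilizer R hQL hLP x ⊓ formStabilizer (wallsAt E m x))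
    {a : Module.Dual ℚ V} (ha : a ∈ E) : dact z a ∈ E := by
  obtain ⟨v, hv⟩ := F.exists_pos_on_wallsAt x
  exact (F.dact_mem_of_pos hx hz.1.1 (hLP hz.1.2) hv
    (fun b hb => hv _ (dact_mem_of_mem_formStabilizer (inv_mem hz.2) hb)) ha).1

lemma exists_Wcirc_mul_mem_stabilizer (F : IsAlcoveFrame R E n m) {x : V}
    (hx : ∀ a ∈ E, m a ≤ a x) {w : V ≃ₗ[ℚ] V} (hw : w ∈ latticeStabilizer R hQL hLP x) :
    ∃ u ∈ Wcirc R x,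
      u * w ∈ latticeStabilizer R hQL hLP x ⊓ formStabilizer (wallsAt E m x) := by
  obtain ⟨v, hv⟩ := F.exists_pos_on_wallsAt x
  have hmul {u : V ≃ₗ[ℚ] V} (hu : u ∈ Wcirc R x) : u * w ∈ latticeStabilizer R hQL hLP x :=
    mul_mem (Wcirc_le_latticeStabilizer hQL hLP x hu) hw
  obtain ⟨u, hu, hpos⟩ := exists_mem_Wcirc_forall_pos R (y := w v)
    (F.wallsAt_subset_PhiOf x) hv (by
      intro u hu a ha
      obtain ⟨haΦ, k, hk⟩ := F.wallsAt_subset_PhiOf x ha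
      obtain ⟨j, hj⟩ := hLP (hmul hu).2 a haΦ
      refine F.apply_ne_zero_of_mem_PhiOf hx hv (β := dact (u * w)⁻¹ a)
        ⟨(dact_mem_iff R (inv_mem (hmul hu).1) a).2 haΦ, j + k, ?_⟩
      rw [dact_inv_apply]
      rw [map_sub] at hj
      push_cast
      linarith)
  refine ⟨u, hu, hmul hu, mem_formStabilizer_of_forall (fun a ha => ?_) fun a ha => ?_⟩
  · exact (F.dact_mem_of_pos hx (hmul hu).1 (hLP (hmul hu).2) hv hpos ha.1).2 ha
  · have hinv := inv_mem (hmul hu)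
    refine (F.dact_mem_of_pos hx hinv.1 (hLP hinv.2) hpos (fun b hb => ?_) ha.1).2 ha
    convert hv b hb using 2
    exact (u * w).symm_apply_apply v

/-- A vector taking two nonzero values of opposite sign on two disjoint sets of walls, and
vanishing on the other walls. -/
lemma exists_vec_of_disjoint (F : IsAlcoveFrame R E n m) {S T : Set (Module.Dual ℚ V)}
    (hST : Disjoint S T) {b : Module.Dual ℚ V} (hb : b ∈ E) (hbT : b ∈ T) :
    ∃ v : V, ∃ p q : ℚ, p ≠ 0 ∧ (∀ e ∈ E, e ∈ S → e v = p) ∧ (∀ e ∈ E, e ∈ T → e v = q) ∧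
      ∀ e ∈ E, e ∉ S → e ∉ T → e v = 0 := by
  classical
  have hT : 0 < ∑ e ∈ E with e ∈ T, n e :=
    Finset.sum_pos (fun e he => F.pos e (Finset.mem_filter.1 he).1)
      ⟨b, Finset.mem_filter.2 ⟨hb, hbT⟩⟩
  obtain ⟨v, hv⟩ := F.exists_vec
    (fun e => (if e ∈ S then ∑ e ∈ E with e ∈ T, n e else 0) -
      if e ∈ T then ∑ e ∈ E with e ∈ S, n e else 0) (by
    simp only [mul_sub, Finset.sum_sub_distrib, mul_ite, mul_zero, ← Finset.sum_filter,
      ← Finset.sum_mul]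
    ring)
  refine ⟨v, _, -(∑ e ∈ E with e ∈ S, n e), hT.ne', fun e he heS => ?_, fun e he heT => ?_,
    fun e he heS heT => ?_⟩
  · rw [hv e he, if_pos heS, if_neg (hST.notMem_of_mem_left heS), sub_zero]
  · rw [hv e he, if_neg (hST.notMem_of_mem_right heT), if_pos heT, zero_sub]
  · rw [hv e he, if_neg heS, if_neg heT, sub_zero]

theorem isolated_iff (F : IsAlcoveFrame R E n m) {x : V} (hx : ∀ a ∈ E, m a ≤ a x) :
    fixedSub (Wcirc R x : Set (V ≃ₗ[ℚ] V)) = ⊥ ↔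
      ∃ a, (E : Set (Module.Dual ℚ V)) \ wallsAt E m x = {a} := by
  simp only [Submodule.eq_bot_iff, F.mem_fixedSub_Wcirc_iff hx]
  constructor
  · intro h
    obtain ⟨a, ha, hax⟩ := F.exists_notMem_wallsAt x
    refine ⟨a, Set.eq_singleton_iff_unique_mem.2 ⟨⟨ha, hax⟩, fun b hb => ?_⟩⟩
    by_contra hba
    obtain ⟨v, p, -, hp, hv, -, h0⟩ := F.exists_vec_of_disjoint
      (Set.disjoint_singleton.2 (Ne.symm hba)) hb.1 rfl
    have hv0 := h v fun e he => h0 e he.1 (fun h => hax (h ▸ he)) fun h => hb.2 (h ▸ he)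
    exact hp (by rw [← hv a ha rfl, hv0, map_zero])
  · rintro ⟨a, ha⟩ v hv
    have haE : a ∈ E := (ha.symm.subset rfl).1
    have hne (e : Module.Dual ℚ V) (he : e ∈ E) (hea : e ≠ a) : e v = 0 :=
      hv e (by_contra fun h => hea (ha.subset ⟨he, h⟩))
    refine F.eq_zero v fun e he => ?_
    by_cases hea : e = a
    · have hsum := F.sum_mul_apply v
      rw [Finset.sum_eq_single a (fun e he hea => by rw [hne e he hea, mul_zero])
        fun h => absurd haE h] at hsum
      exact hea ▸ (mul_eq_zero.1 hsum).resolve_left (F.pos a haE).ne'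
    · exact hne e he hea

theorem quasiIsolated_iff (F : IsAlcoveFrame R E n m) {x : V} (hx : ∀ a ∈ E, m a ≤ a x) :
    fixedSub (latticeStabilizer R hQL hLP x : Set (V ≃ₗ[ℚ] V)) = ⊥ ↔
      ∀ α ∈ (E : Set (Module.Dual ℚ V)) \ wallsAt E m x,
        ∀ β ∈ (E : Set (Module.Dual ℚ V)) \ wallsAt E m x,
          ∃ w ∈ latticeStabilizer R hQL hLP x ⊓ formStabilizer (wallsAt E m x),
            dact w α = β := by
  set A := latticeStabilizer R hQL hLP x ⊓ formStabilizer (wallsAt E m x) with hA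
  rw [Submodule.eq_bot_iff]
  constructor
  · intro h α hα β hβ
    by_contra! hno
    let orbit (γ : Module.Dual ℚ V) : Set (Module.Dual ℚ V) := {e | ∃ w ∈ A, dact w γ = e}
    have self_mem (γ : Module.Dual ℚ V) : γ ∈ orbit γ := ⟨1, one_mem A, rfl⟩
    have orbit_iff {z : V ≃ₗ[ℚ] V} (hz : z ∈ A) (γ e : Module.Dual ℚ V) :
        dact z e ∈ orbit γ ↔ e ∈ orbit γ := by
      constructor
      · rintro ⟨w, hw, hwe⟩
        exact ⟨z⁻¹ * w, mul_mem (inv_mem hz) hw, by rw [dact_mul, hwe, dact_inv_dact]⟩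
      · rintro ⟨w, hw, rfl⟩
        exact ⟨z * w, mul_mem hz hw, rfl⟩
    have orbit_walls {γ e : Module.Dual ℚ V} (hγ : γ ∉ wallsAt E m x)
        (he : e ∈ wallsAt E m x) : e ∉ orbit γ := by
      rintro ⟨w, hw, rfl⟩
      have := dact_mem_of_mem_formStabilizer (inv_mem hw.2) he
      rw [dact_inv_dact] at this
      exact hγ this
    have hdisj : Disjoint (orbit α) (orbit β) := by
      rw [Set.disjoint_left]
      rintro _ ⟨w, hw, rfl⟩ ⟨z, hz, hzw⟩
      exact hno (z⁻¹ * w) (mul_mem (inv_mem hz) hw) (by rw [dact_mul, ← hzw, dact_inv_dact])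
    obtain ⟨v, p, q, hp, hvα, hvβ, hv0⟩ := F.exists_vec_of_disjoint hdisj hβ.1 (self_mem β)
    have hAv (z : V ≃ₗ[ℚ] V) (hz : z ∈ A) : z v = v := by
      rw [← sub_eq_zero]
      refine F.eq_zero _ fun e he => ?_
      rw [map_sub, sub_eq_zero, ← dact_inv_apply]
      have hz' := inv_mem hz
      have he' := F.dact_mem_of_mem_stabilizer hQL hLP hx hz' he
      by_cases heα : e ∈ orbit α
      · rw [hvα e he heα, hvα _ he' ((orbit_iff hz' _ _).2 heα)]
      by_cases heβ : e ∈ orbit β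
      · rw [hvβ e he heβ, hvβ _ he' ((orbit_iff hz' _ _).2 heβ)]
      rw [hv0 e he heα heβ, hv0 _ he' (mt (orbit_iff hz' _ _).1 heα)
        (mt (orbit_iff hz' _ _).1 heβ)]
    have hcirc := (F.mem_fixedSub_Wcirc_iff hx).2 fun e he =>
      hv0 e he.1 (orbit_walls hα.2 he) (orbit_walls hβ.2 he)
    have hv : v = 0 := h v fun w hw => by
      obtain ⟨u, hu, huw⟩ := F.exists_Wcirc_mul_mem_stabilizer hQL hLP hx hw
      refine u.injective ?_
      rw [← LinearEquiv.mul_apply, hAv _ huw, hcirc u hu]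
    exact hp (by rw [← hvα α hα.1 (self_mem α), hv, map_zero])
  · intro h v hv
    have hwalls := (F.mem_fixedSub_Wcirc_iff hx).1 fun w hw =>
      hv w (Wcirc_le_latticeStabilizer hQL hLP x hw)
    obtain ⟨a, ha, hax⟩ := F.exists_notMem_wallsAt x
    have hconst (e : Module.Dual ℚ V) (he : e ∈ E) (hex : e ∉ wallsAt E m x) :
        e v = a v := by
      obtain ⟨w, hw, rfl⟩ := h a ⟨ha, hax⟩ e ⟨he, hex⟩
      rw [dact_apply, w.symm_apply_eq.2 (hv w hw.1).symm]
    have hav : a v = 0 := by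
      classical
      have hN : 0 < ∑ e ∈ E with e ∉ wallsAt E m x, n e :=
        Finset.sum_pos (fun e he => F.pos e (Finset.mem_filter.1 he).1)
          ⟨a, Finset.mem_filter.2 ⟨ha, hax⟩⟩
      have hsum := F.sum_mul_apply v
      rw [Finset.sum_congr rfl (g := fun e => (if e ∉ wallsAt E m x then n e else 0) * a v)
        fun e he => by
          by_cases hex : e ∈ wallsAt E m x
          · rw [hwalls e hex, if_neg (not_not.2 hex), mul_zero, zero_mul]
          · rw [hconst e he hex, if_pos hex],
        ← Finset.sum_mul, ← Finset.sum_filter] at hsum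
      exact (mul_eq_zero.1 hsum).resolve_left hN.ne'
    refine F.eq_zero v fun e he => ?_
    by_cases hex : e ∈ wallsAt E m x
    · exact hwalls e hex
    · rw [hconst e he hex, hav]

end IsAlcoveFrame

end AlcoveFrame

section FundamentalAlcove

lemma exists_forall_apply_eq [FiniteDimensional ℚ V] {Δ : Finset (Module.Dual ℚ V)}
    (hΔ : LinearIndependent ℚ
      (fun x : (Δ : Set (Module.Dual ℚ V)) => (x : Module.Dual ℚ V)))
    (f : Module.Dual ℚ V → ℚ) : ∃ v : V, ∀ a ∈ Δ, a v = f a := by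
  obtain ⟨φ, hφ⟩ : ∃ φ : Module.Dual ℚ (Module.Dual ℚ V), ∀ a ∈ Δ, φ a = f a := by
    obtain ⟨φ, hφ⟩ := LinearMap.exists_extend
      ((Module.Basis.span hΔ).constr ℚ fun i => f i)
    refine ⟨φ, fun a ha => ?_⟩
    have h := (Module.Basis.span hΔ).constr_basis ℚ (fun i => f i) ⟨a, ha⟩
    rw [← hφ, LinearMap.comp_apply, Submodule.subtype_apply, Module.Basis.span_apply] at h
    exact h
  refine ⟨(Module.evalEquiv ℚ V).symm φ, fun a ha => ?_⟩
  rw [Module.apply_evalEquiv_symm_apply]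
  exact hφ a ha

lemma exists_sum_insert_eq [DecidableEq (Module.Dual ℚ V)] {Δ : Finset (Module.Dual ℚ V)}
    {αt : Module.Dual ℚ V} (hα₀ : -αt ∉ Δ) (r : ℚ) (g : Module.Dual ℚ V → ℚ) :
    ∃ c : Module.Dual ℚ V → ℚ, c (-αt) = r ∧ (∀ a ∈ Δ, c a = g a) ∧
      ∀ y, ∑ a ∈ insert (-αt) Δ, c a * (a y - mfun αt a) =
        r * (1 - αt y) + ∑ a ∈ Δ, g a * a y := by
  have hne (a : Module.Dual ℚ V) (ha : a ∈ Δ) : a ≠ -αt := ne_of_mem_of_not_mem ha hα₀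
  refine ⟨Function.update g (-αt) r, Function.update_self .., fun a ha =>
    Function.update_of_ne (hne a ha) .., fun y => ?_⟩
  rw [Finset.sum_insert hα₀, Function.update_self, mfun, if_pos rfl, LinearMap.neg_apply,
    sub_neg_eq_add, neg_add_eq_sub]
  congr 1
  refine Finset.sum_congr rfl fun a ha => ?_
  rw [Function.update_of_ne (hne a ha), mfun, if_neg (hne a ha), sub_zero]

lemma exists_comb_of_le [DecidableEq (Module.Dual ℚ V)] {Δ : Finset (Module.Dual ℚ V)}
    {αt : Module.Dual ℚ V} (hα₀ : -αt ∉ Δ) {N c : Module.Dual ℚ V → ℚ}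
    (hN : ∀ y, αt y = ∑ a ∈ Δ, N a * a y) (hN0 : ∀ a ∈ Δ, 0 < N a) {β : Module.Dual ℚ V}
    (hc : ∀ y, β y = ∑ a ∈ Δ, c a * a y) (hc0 : ∀ a ∈ Δ, 0 ≤ c a)
    (hcN : ∀ a ∈ Δ, c a ≤ N a) (k : ℤ) :
    ∃ c : Module.Dual ℚ V → ℚ, (∀ a ∈ insert (-αt) Δ, 0 ≤ c a) ∧
      ((∀ y, β y + k = ∑ a ∈ insert (-αt) Δ, c a * (a y - mfun αt a)) ∨
        (∀ y, -(β y + k) = ∑ a ∈ insert (-αt) Δ, c a * (a y - mfun αt a))) := by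
  rcases le_or_gt 0 k with hk | hk
  · have hk' : (0 : ℚ) ≤ k := by exact_mod_cast hk
    obtain ⟨d, hd, hdΔ, hsum⟩ := exists_sum_insert_eq hα₀ k fun a => c a + k * N a
    refine ⟨d, (Finset.forall_mem_insert _ _ _).2 ⟨hd.symm ▸ hk', fun a ha => ?_⟩,
      Or.inl fun y => ?_⟩
    · rw [hdΔ a ha]
      exact add_nonneg (hc0 a ha) (mul_nonneg hk' (hN0 a ha).le)
    · rw [hsum]
      simp only [add_mul, mul_assoc, Finset.sum_add_distrib]
      rw [← Finset.mul_sum, ← hN, ← hc]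
      ring
  · have hk' : (k : ℚ) ≤ -1 := by exact_mod_cast Int.le_sub_one_of_lt hk
    obtain ⟨d, hd, hdΔ, hsum⟩ :=
      exists_sum_insert_eq hα₀ (-k) fun a => N a - c a + (-k - 1) * N a
    refine ⟨d, (Finset.forall_mem_insert _ _ _).2 ⟨by linarith, fun a ha => ?_⟩,
      Or.inr fun y => ?_⟩
    · rw [hdΔ a ha]
      exact add_nonneg (sub_nonneg.2 (hcN a ha))
        (mul_nonneg (by linarith) (hN0 a ha).le)
    · rw [hsum]
      simp only [add_mul _ (_ * _), sub_mul (N _), mul_assoc, Finset.sum_add_distrib,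
        Finset.sum_sub_distrib]
      rw [← Finset.mul_sum, ← hN, ← hc]
      ring

/-- The walls of the fundamental alcove form an alcove frame. -/
theorem exists_isAlcoveFrame [FiniteDimensional ℚ V] [DecidableEq (Module.Dual ℚ V)]
    (R : RootSystemData V) (Δ : Finset (Module.Dual ℚ V))
    (hΔΦ : (Δ : Set (Module.Dual ℚ V)) ⊆ R.Φ)
    (hΔind : LinearIndependent ℚ
      (fun x : (Δ : Set (Module.Dual ℚ V)) => (x : Module.Dual ℚ V)))
    (hΔbase : ∀ α ∈ R.Φ, ∃ c : Module.Dual ℚ V →₀ ℤ,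
        (c.support : Set (Module.Dual ℚ V)) ⊆ (Δ : Set (Module.Dual ℚ V)) ∧
        α = c.sum (fun β k => (k : ℚ) • β) ∧
        ((∀ β, 0 ≤ c β) ∨ (∀ β, c β ≤ 0)))
    (αt : Module.Dual ℚ V) (hαtΦ : αt ∈ R.Φ)
    (hhigh : ∀ γ ∈ R.Φ, ∃ c : Module.Dual ℚ V →₀ ℚ,
        (c.support : Set (Module.Dual ℚ V)) ⊆ (Δ : Set (Module.Dual ℚ V)) ∧
        αt - γ = c.sum (fun β k => k • β) ∧ (∀ β, 0 ≤ c β))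
    (hα₀ : -αt ∉ Δ) :
    ∃ n, IsAlcoveFrame R (insert (-αt) Δ) n (mfun αt) := by
  have base (β : Module.Dual ℚ V) (hβ : β ∈ R.Φ) : ∃ c : Module.Dual ℚ V → ℚ,
      (∀ y, β y = ∑ a ∈ Δ, c a * a y) ∧ ((∀ a, 0 ≤ c a) ∨ ∀ a, c a ≤ 0) := by
    obtain ⟨c, hc, hsum, hsign⟩ := hΔbase β hβ
    refine ⟨fun a => c a, fun y => ?_, ?_⟩
    · rw [Finsupp.sum_of_support_subset c (Finset.coe_subset.1 hc) _ (by simp)] at hsum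
      simpa using congrArg (· y) hsum
    · exact hsign.imp (fun h a => Int.cast_nonneg (h a)) fun h a => Int.cast_nonpos.2 (h a)
  have high (β : Module.Dual ℚ V) (hβ : β ∈ R.Φ) : ∃ c : Module.Dual ℚ V → ℚ,
      (∀ y, αt y - β y = ∑ a ∈ Δ, c a * a y) ∧ ∀ a, 0 ≤ c a := by
    obtain ⟨c, hc, hsum, hsign⟩ := hhigh β hβ
    refine ⟨c, fun y => ?_, hsign⟩
    rw [Finsupp.sum_of_support_subset c (Finset.coe_subset.1 hc) _ (by simp)] at hsum
    simpa using congrArg (· y) hsum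
  have coweight (a : Module.Dual ℚ V) (ha : a ∈ Δ) :
      ∃ v : V, a v = 1 ∧ ∀ c : Module.Dual ℚ V → ℚ, ∑ b ∈ Δ, c b * b v = c a := by
    obtain ⟨v, hv⟩ := exists_forall_apply_eq hΔind fun b => if b = a then 1 else 0
    refine ⟨v, by rw [hv a ha, if_pos rfl], fun c => ?_⟩
    rw [Finset.sum_congr rfl fun b hb => by rw [hv b hb]]
    simp [ha]
  obtain ⟨N, hN, -⟩ := base αt hαtΦ
  have le_N {β : Module.Dual ℚ V} (hβ : β ∈ R.Φ) {c : Module.Dual ℚ V → ℚ}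
      (hc : ∀ y, β y = ∑ a ∈ Δ, c a * a y) {a : Module.Dual ℚ V} (ha : a ∈ Δ) :
      c a ≤ N a := by
    obtain ⟨d, hd, hd0⟩ := high β hβ
    obtain ⟨v, -, hv⟩ := coweight a ha
    have h := hd v
    rw [hN, hc, hv, hv, hv] at h
    linarith [hd0 a]
  have N_pos (a : Module.Dual ℚ V) (ha : a ∈ Δ) : 0 < N a := by
    obtain ⟨d, hd, hd0⟩ := high a (hΔΦ ha)
    obtain ⟨v, hav, hv⟩ := coweight a ha
    have h := hd v
    rw [hN, hav, hv, hv] at h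
    linarith [hd0 a]
  obtain ⟨n, hn, hnΔ, hsum⟩ := exists_sum_insert_eq hα₀ 1 N
  refine ⟨n, ?_, ?_, ?_, ?_, ?_, ?_, ?_⟩
  · exact (Finset.forall_mem_insert _ _ _).2 ⟨R.neg_mem hαtΦ, fun a ha => hΔΦ ha⟩
  · exact (Finset.forall_mem_insert _ _ _).2
      ⟨hn.symm ▸ one_pos, fun a ha => (hnΔ a ha).symm ▸ N_pos a ha⟩
  · intro a _
    by_cases h : a = -αt
    · exact ⟨-1, by simp [mfun, h]⟩
    · exact ⟨0, by simp [mfun, h]⟩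
  · intro y
    rw [hsum, ← hN]
    ring
  · intro f hf
    obtain ⟨v, hv⟩ := exists_forall_apply_eq hΔind f
    refine ⟨v, (Finset.forall_mem_insert _ _ _).2 ⟨?_, hv⟩⟩
    rw [Finset.sum_insert hα₀, hn, one_mul] at hf
    rw [LinearMap.neg_apply, hN, ← add_eq_zero_iff_neg_eq', ← hf]
    congr 1
    exact Finset.sum_congr rfl fun a ha => by rw [hv a ha, hnΔ a ha]
  · intro v hv
    have hΦ : R.Φ ⊆ LinearMap.ker (Module.Dual.eval ℚ V v) := fun β hβ => by
      obtain ⟨c, hc, -⟩ := base β hβ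
      change β v = 0
      rw [hc]
      exact Finset.sum_eq_zero fun a ha => by
        rw [hv a (Finset.mem_insert_of_mem ha), mul_zero]
    have htop := Submodule.span_le.2 hΦ
    rw [R.span_eq_top] at htop
    exact (Module.forall_dual_apply_eq_zero_iff ℚ v).1 fun f => htop trivial
  · intro β hβ k
    obtain ⟨c, hc, h0 | h0⟩ := base β hβ
    · exact exists_comb_of_le hα₀ hN N_pos hc (fun a _ => h0 a) (fun a ha => le_N hβ hc ha) k
    · have hneg (y : V) : (-β) y = ∑ a ∈ Δ, -c a * a y := by
        simp only [LinearMap.neg_apply, hc, neg_mul, Finset.sum_neg_distrib]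
      obtain ⟨d, hd, h⟩ := exists_comb_of_le hα₀ hN N_pos hneg
        (fun a _ => neg_nonneg.2 (h0 a)) (fun a ha => le_N (R.neg_mem hβ) hneg ha) (-k)
      refine ⟨d, hd, h.symm.imp (fun h y => ?_) fun h y => ?_⟩ <;> rw [← h] <;>
        simp only [LinearMap.neg_apply, Int.cast_neg] <;> ring

end FundamentalAlcove

/-- Let λ ∈ C. (a) λ is isolated (W°(λ) fixes no nonzero vector) iff
Δ̃ ∖ I_λ has exactly one element; (b) λ is quasi-isolated w.r.t. L (W_L(λ) fixes no
nonzero vector) iff A_L(λ) = {w ∈ W | w(λ)−λ ∈ L, w(I_λ)=I_λ} acts transitively on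
Δ̃ ∖ I_λ. -/
theorem isolated_and_quasiIsolated_criterion
    {V : Type*} [AddCommGroup V] [Module ℚ V] [FiniteDimensional ℚ V]
    (R : RootSystemData V)
    (Δ : Finset (Module.Dual ℚ V))
    (hΔΦ : (Δ : Set (Module.Dual ℚ V)) ⊆ R.Φ)
    (hΔind : LinearIndependent ℚ
      (fun x : (Δ : Set (Module.Dual ℚ V)) => (x : Module.Dual ℚ V)))
    (hΔbase : ∀ α ∈ R.Φ, ∃ c : Module.Dual ℚ V →₀ ℤ,
        (c.support : Set (Module.Dual ℚ V)) ⊆ (Δ : Set (Module.Dual ℚ V)) ∧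
        α = c.sum (fun β k => (k : ℚ) • β) ∧
        ((∀ β, 0 ≤ c β) ∨ (∀ β, c β ≤ 0)))
    (αt : Module.Dual ℚ V) (hαtΦ : αt ∈ R.Φ)
    (hhigh : ∀ γ ∈ R.Φ, ∃ c : Module.Dual ℚ V →₀ ℚ,
        (c.support : Set (Module.Dual ℚ V)) ⊆ (Δ : Set (Module.Dual ℚ V)) ∧
        αt - γ = c.sum (fun β k => k • β) ∧ (∀ β, 0 ≤ c β))
    (hα₀ : -αt ∉ (Δ : Set (Module.Dual ℚ V)))
    (L : AddSubgroup V)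
    (hQL : (corootLattice R : Set V) ⊆ (L : Set V))
    (hLP : (L : Set V) ⊆ coweightSet R)
    (x : V) (hx : x ∈ alcove Δ αt) :
    ((fixedSub (Wcirc R x : Set (V ≃ₗ[ℚ] V)) = ⊥) ↔
      (∃ a, extBase Δ αt \ IOf Δ αt x = {a})) ∧
    ((fixedSub {w : V ≃ₗ[ℚ] V | w ∈ weyl R ∧ w x - x ∈ L} = ⊥) ↔
      (∀ α ∈ extBase Δ αt \ IOf Δ αt x, ∀ β ∈ extBase Δ αt \ IOf Δ αt x,
        ∃ w : V ≃ₗ[ℚ] V, (w ∈ weyl R ∧ w x - x ∈ L ∧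
          dact w '' IOf Δ αt x = IOf Δ αt x) ∧ dact w α = β)) := by
  classical
  obtain ⟨n, F⟩ := exists_isAlcoveFrame R Δ hΔΦ hΔind hΔbase αt hαtΦ hhigh hα₀
  have hE : extBase Δ αt = (insert (-αt) Δ : Finset (Module.Dual ℚ V)) :=
    (Finset.coe_insert _ _).symm
  have hI : IOf Δ αt x = wallsAt (insert (-αt) Δ) (mfun αt) x := by
    rw [IOf, hE]
    rfl
  have hx' : ∀ a ∈ insert (-αt) Δ, mfun αt a ≤ a x := fun a ha =>
    hx a (hE.symm.subset ha)
  rw [hE, hI]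
  refine ⟨F.isolated_iff hx', (F.quasiIsolated_iff hQL hLP hx').trans ?_⟩
  refine forall₂_congr fun α _ => forall₂_congr fun β _ => exists_congr fun w => ?_
  exact and_congr_left' and_assoc
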